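/- Let m, n be coprime, let p be an (m,n)-parking word, and let x ∈ V^m be its unique fixed point. Then the sequence of intermediate points x = x^{(0)}, x^{(1)}, ..., x^{(n)} = x obtained by applying the letters of p one at a time determines p uniquely; consequently, the map B sending a parking (m,n)-filter tuple 𝔭 to the word recording, at each of the n steps, the relative order (rank) within m(𝔭^{(i−1)}) of the level removed at step i, is injective from parking (m,n)-filter tuples to [m]^n, and its image is exactly the set of (m,n)-parking words. -/

import Mathlib

def IsParkingWord (m n : ℕ) (p : Fin n → ℕ) : Prop :=
  (∀ j, p j < m) ∧
  ∀ i : ℕ, 1 ≤ i → i ≤ m →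
    i * n ≤ m * (Finset.univ.filter (fun j => p j < i)).card

noncomputable def sortTuple {m : ℕ} (x : Fin m → ℝ) : Fin m → ℝ :=
  x ∘ Tuple.sort x

noncomputable def letterAct (m : ℕ) (i : Fin m) (x : Fin m → ℝ) : Fin m → ℝ :=
  sortTuple (fun j => x j + (if j = i then (m : ℝ) else 0) - 1)

noncomputable def wordAct {m n : ℕ} (w : Fin n → Fin m) (x : Fin m → ℝ) : Fin m → ℝ :=
  (List.ofFn w).foldl (fun y i => letterAct m i y) x

/-- The action of the first `i` letters of the word `w` (left to right). -/
noncomputable def partialAct {m n : ℕ} (w : Fin n → Fin m) (i : ℕ)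
    (x : Fin m → ℝ) : Fin m → ℝ :=
  ((List.ofFn w).take i).foldl (fun y l => letterAct m l y) x

def Vm (m : ℕ) : Set (Fin m → ℝ) :=
  {x | (∑ j, x j) = 0 ∧ Monotone x}

/-- A parking (m,n)-filter tuple, recorded by the sorted `m`-tuples
`r i = m(𝔭^{(i)})` of row-minimal levels of the filters `𝔭^{(0)}, ..., 𝔭^{(n)}`,
together with the removed levels `p_0, ..., p_{n-1}`.  The initial filter is a
Dyck filter (minimum level `0`), at each step the removed level `p_i` is replaced
by `p_i + m`, and after `n` steps all row minima have increased by `n`. -/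
structure ParkingTuple (m n : ℕ) where
  r : Fin (n + 1) → Fin m → ℤ
  removed : Fin n → ℤ
  mono : ∀ i, Monotone (r i)
  res : ∀ i, ∀ j k : Fin m, (m : ℤ) ∣ (r i j - r i k) → j = k
  nonneg : ∀ j, 0 ≤ r 0 j
  zero_min : ∃ j, r 0 j = 0
  closed : ∀ j, ∃ j' : Fin m, ∃ k : ℕ, r 0 j + (n : ℤ) = r 0 j' + (k : ℤ) * (m : ℤ)
  mem : ∀ i : Fin n, removed i ∈ Multiset.map (r i.castSucc) Finset.univ.val
  step : ∀ i : Fin n,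
    Multiset.map (r i.succ) Finset.univ.val =
      (removed i + (m : ℤ)) ::ₘ
        (Multiset.map (r i.castSucc) Finset.univ.val).erase (removed i)
  last : ∀ j, r (Fin.last n) j = r 0 j + (n : ℤ)

/-- The map `B`: at step `i` record the rank of the removed level within the
current sorted tuple of row minima. -/
def Brank {m n : ℕ} (t : ParkingTuple m n) (i : Fin n) : ℕ :=
  (Finset.univ.filter (fun j : Fin m => t.r i.castSucc j < t.removed i)).card

lemma sum_sortTuple {m : ℕ} (a : Fin m → ℝ) (f : ℝ → ℝ) :
    ∑ j, f (sortTuple a j) = ∑ j, f (a j) :=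
  Equiv.sum_comp (Tuple.sort a) (fun j => f (a j))

lemma monotone_letterAct (m : ℕ) (i : Fin m) (x : Fin m → ℝ) : Monotone (letterAct m i x) :=
  Tuple.monotone_sort (fun j => x j + (if j = i then (m : ℝ) else 0) - 1)

lemma sum_letterAct (m : ℕ) (i : Fin m) (x : Fin m → ℝ) :
    ∑ j, letterAct m i x j = ∑ j, x j := by
  have h := sum_sortTuple (fun j => x j + (if j = i then (m : ℝ) else 0) - 1) id
  simp only [id] at h
  rw [letterAct, h]
  simp [Finset.sum_add_distrib, Finset.sum_sub_distrib]

/-- Change of the squared norm under a letter. -/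
lemma sum_sq_letterAct (m : ℕ) (i : Fin m) (x : Fin m → ℝ) :
    ∑ j, letterAct m i x j ^ 2 =
      ∑ j, x j ^ 2 - 2 * ∑ j, x j + 2 * m * x i + (m ^ 2 - m) := by
  have h := sum_sortTuple (fun j => x j + (if j = i then (m : ℝ) else 0) - 1) (fun t => t ^ 2)
  rw [letterAct, h]
  have key : ∀ j, (x j + (if j = i then (m : ℝ) else 0) - 1) ^ 2 =
      x j ^ 2 - 2 * x j + 1 + (if j = i then 2 * m * x i + m ^ 2 - 2 * m else 0) := by
    intro j
    split_ifs with hj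
    · subst hj; ring
    · ring
  simp only [key, Finset.sum_add_distrib, Finset.sum_sub_distrib, ← Finset.mul_sum]
  simp
  ring

lemma letter_eq_of_letterAct_eq {m : ℕ} {x : Fin m → ℝ} (hx : Function.Injective x)
    {i i' : Fin m} (h : letterAct m i x = letterAct m i' x) : i = i' := by
  have h1 := sum_sq_letterAct m i x
  rw [h, sum_sq_letterAct m i' x] at h1
  have hm : (0 : ℝ) < m := by exact_mod_cast i.pos
  apply hx
  have h2 : (2 * m : ℝ) * x i' = 2 * m * x i := by linarith
  exact (mul_left_cancel₀ (by positivity) h2).symm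

/-- Sorting does not increase the squared distance. In the equality case, a tuple with distinct
entries and the other one are sorted by the same permutation. -/
lemma sum_sq_sortTuple_sub_le {m : ℕ} (a b : Fin m → ℝ) :
    ∑ j, (sortTuple a j - sortTuple b j) ^ 2 ≤ ∑ j, (a j - b j) ^ 2 ∧
    (Function.Injective a → ∑ j, (sortTuple a j - sortTuple b j) ^ 2 = ∑ j, (a j - b j) ^ 2 →
      sortTuple b = b ∘ Tuple.sort a) := by
  have hmv : Monovary (sortTuple a) (sortTuple b) :=
    (Tuple.monotone_sort a).monovary (Tuple.monotone_sort b)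
  set σ : Equiv.Perm (Fin m) := (Tuple.sort a).trans (Tuple.sort b).symm with hσ
  have hbσ : ∀ j, sortTuple b (σ j) = b (Tuple.sort a j) := by
    intro j; simp [sortTuple, hσ]
  have hab : ∑ j, sortTuple a j * sortTuple b (σ j) = ∑ j, a j * b j := by
    simp only [hbσ]
    exact Equiv.sum_comp (Tuple.sort a) (fun j => a j * b j)
  have hle : ∑ j, a j * b j ≤ ∑ j, sortTuple a j * sortTuple b j := by
    rw [← hab]; exact hmv.sum_mul_comp_perm_le_sum_mul
  have exp : ∀ f g : Fin m → ℝ, ∑ j, (f j - g j) ^ 2 =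
      ∑ j, f j ^ 2 + ∑ j, g j ^ 2 - 2 * ∑ j, f j * g j := by
    intro f g
    rw [Finset.mul_sum, ← Finset.sum_add_distrib, ← Finset.sum_sub_distrib]
    exact Finset.sum_congr rfl fun j _ => by ring
  have ha := sum_sortTuple a (fun t => t ^ 2)
  have hb := sum_sortTuple b (fun t => t ^ 2)
  rw [exp, exp, ha, hb]
  refine ⟨by linarith, fun hinj heq => ?_⟩
  have hmv' := (hmv.sum_mul_comp_perm_eq_sum_mul_iff (σ := σ)).1 (by rw [hab]; linarith)
  have hs : StrictMono (sortTuple a) :=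
    (Tuple.monotone_sort a).strictMono_of_injective
      (hinj.comp (Tuple.sort a).injective)
  refine (Tuple.comp_sort_eq_comp_iff_monotone.2 ?_).symm
  have : b ∘ Tuple.sort a = sortTuple b ∘ σ := by
    funext j; exact (hbσ j).symm
  rw [this]
  intro i j hij
  by_contra! hlt
  have h1 := hmv' hlt
  rcases hij.lt_or_eq with h | h
  · exact absurd (hs h) (not_lt.2 h1)
  · subst h; exact lt_irrefl _ hlt

/-- The sum of the `i` smallest entries is at most the sum of the first `i` entries. -/
lemma sum_sortTuple_lt_le {m : ℕ} (a : Fin m → ℝ) (i : ℕ) :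
    ∑ j with j.val < i, sortTuple a j ≤ ∑ j with j.val < i, a j := by
  have hg : Antitone (fun j : Fin m => if j.val < i then (1 : ℝ) else 0) := by
    intro j k hjk
    have : j.val ≤ k.val := hjk
    simp only
    split_ifs <;> first | omega | norm_num
  have := ((Tuple.monotone_sort a).antivary hg).sum_mul_le_sum_comp_perm_mul
    (σ := (Tuple.sort a).symm)
  simp only [Function.comp, Equiv.apply_symm_apply] at this
  simpa [Finset.sum_filter, sortTuple] using this

lemma sortTuple_le_add {m : ℕ} {a b : Fin m → ℝ} {c : ℝ} (h : ∀ j, b j ≤ a j + c) (k : Fin m) :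
    sortTuple b k ≤ sortTuple a k + c := by
  rw [← Tuple.lt_card_le_iff_apply_le_of_monotone (f := sortTuple b) (Tuple.monotone_sort b)]
  have h1 := (Tuple.lt_card_le_iff_apply_le_of_monotone (f := sortTuple a) (j := k)
    (a := sortTuple a k) (Tuple.monotone_sort a)).2 le_rfl
  refine h1.trans_le ?_
  have card : ∀ (f : Fin m → ℝ) (t : ℝ), (Finset.univ.filter (fun j => sortTuple f j ≤ t)).card =
      (Finset.univ.filter (fun j => f j ≤ t)).card := by
    intro f t
    refine Finset.card_equiv (Tuple.sort f) ?_
    intro j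
    simp only [Finset.mem_filter, Finset.mem_univ, true_and]
    rfl
  rw [card, card]
  refine Finset.card_le_card fun j hj => ?_
  simp only [Finset.mem_filter, Finset.mem_univ, true_and] at hj ⊢
  linarith [h j]

lemma dist_sortTuple_le {m : ℕ} (a b : Fin m → ℝ) :
    dist (sortTuple a) (sortTuple b) ≤ dist a b := by
  refine (dist_pi_le_iff dist_nonneg).2 fun k => ?_
  have hc : ∀ j, |a j - b j| ≤ dist a b := fun j => dist_le_pi_dist a b j
  rw [Real.dist_eq, abs_le]
  have h1 := sortTuple_le_add (a := a) (b := b) (c := dist a b)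
    (fun j => by linarith [(abs_le.1 (hc j)).1]) k
  have h2 := sortTuple_le_add (a := b) (b := a) (c := dist a b)
    (fun j => by linarith [(abs_le.1 (hc j)).2]) k
  constructor <;> linarith

lemma dist_letterAct_le (m : ℕ) (i : Fin m) (x y : Fin m → ℝ) :
    dist (letterAct m i x) (letterAct m i y) ≤ dist x y := by
  refine (dist_sortTuple_le _ _).trans ((dist_pi_le_iff dist_nonneg).2 fun k => ?_)
  refine le_trans (le_of_eq ?_) (dist_le_pi_dist x y k)
  rw [Real.dist_eq, Real.dist_eq]
  congr 1
  ring

lemma sortTuple_of_monotone {m : ℕ} {x : Fin m → ℝ} (hx : Monotone x) : sortTuple x = x := by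
  have := Tuple.comp_sort_eq_comp_iff_monotone (f := x) (σ := 1)
  exact (this.2 (by simpa using hx)).symm

lemma dist_letterAct_self_le {m : ℕ} (i : Fin m) {x : Fin m → ℝ} (hx : Monotone x) :
    dist (letterAct m i x) x ≤ m := by
  have hm : (1 : ℝ) ≤ m := by exact_mod_cast i.pos
  conv_lhs => rw [← sortTuple_of_monotone hx]
  rw [letterAct, sortTuple_of_monotone hx]
  nth_rewrite 2 [← sortTuple_of_monotone hx]
  refine (dist_sortTuple_le _ _).trans ((dist_pi_le_iff (by positivity)).2 fun k => ?_)
  rw [Real.dist_eq, abs_le]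
  split_ifs <;> constructor <;> linarith

lemma Fin.sum_succ_sub_castSucc {n : ℕ} (S : Fin (n + 1) → ℝ) :
    ∑ k : Fin n, (S k.succ - S k.castSucc) = S (Fin.last n) - S 0 := by
  have h1 := Fin.sum_univ_succ S
  have h2 := Fin.sum_univ_castSucc S
  rw [Finset.sum_sub_distrib]
  linarith

/-- The points visited while the letters of `p` act one at a time, ending at the starting point. -/
structure IsClosedTrajectory {m n : ℕ} (p : Fin n → Fin m) (X : Fin (n + 1) → Fin m → ℝ) :
    Prop where
  mono : ∀ i, Monotone (X i)
  step : ∀ i : Fin n, X i.succ = letterAct m (p i) (X i.castSucc)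
  closed : X (Fin.last n) = X 0

lemma letterAct_sort_symm (m : ℕ) (i : Fin m) (x : Fin m → ℝ) (j : Fin m) :
    letterAct m i x ((Tuple.sort fun j => x j + (if j = i then (m : ℝ) else 0) - 1).symm j) =
      x j + (if j = i then (m : ℝ) else 0) - 1 := by
  simp [letterAct, sortTuple]

section Orbit

variable {m n : ℕ} {f : Fin m → ℝ} {τ : Equiv.Perm (Fin m)} {k : Fin m → ℕ}

lemma exists_iterate_eq (h : ∀ j, f (τ j) = f j - n + k j * m) (a : ℕ) (j : Fin m) :
    ∃ z : ℤ, f (τ^[a] j) = f j - a * n + z * m := by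
  induction a with
  | zero => exact ⟨0, by simp⟩
  | succ a ih =>
    obtain ⟨z, hz⟩ := ih
    refine ⟨z + k (τ^[a] j), ?_⟩
    rw [Function.iterate_succ_apply', h, hz]
    push_cast
    ring

lemma eq_of_lt_of_iterate_congr (hcop : Nat.Coprime m n)
    (h : ∀ j, f (τ j) = f j - n + k j * m) {a b : ℕ} (ha : a < m) (hb : b < m) {j : Fin m}
    (hab : ∃ z : ℤ, f (τ^[a] j) - f (τ^[b] j) = z * m) : a = b := by
  obtain ⟨z, hz⟩ := hab
  obtain ⟨u, hu⟩ := exists_iterate_eq h a j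
  obtain ⟨v, hv⟩ := exists_iterate_eq h b j
  have h1 : ((b : ℤ) - a) * n = (z - u + v) * m := by
    have : ((b : ℝ) - a) * n = (z - u + v) * m := by rw [hu, hv] at hz; linarith
    exact_mod_cast this
  have h2 : (m : ℤ) ∣ (b : ℤ) - a :=
    (Nat.isCoprime_iff_coprime.2 hcop).dvd_of_dvd_mul_right ⟨z - u + v, by rw [h1]; ring⟩
  have h3 := (Nat.modEq_iff_dvd (n := m) (a := a) (b := b)).2 h2
  rwa [Nat.ModEq, Nat.mod_eq_of_lt ha, Nat.mod_eq_of_lt hb] at h3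

lemma exists_lt_iterate_eq (hcop : Nat.Coprime m n)
    (h : ∀ j, f (τ j) = f j - n + k j * m) (j l : Fin m) : ∃ a < m, τ^[a] j = l := by
  have hinj : Function.Injective (fun a : Fin m => τ^[a.val] j) := by
    intro a b hab
    simp only at hab
    exact Fin.ext (eq_of_lt_of_iterate_congr hcop h a.2 b.2 ⟨0, by rw [hab]; simp⟩)
  obtain ⟨a, ha⟩ := (Finite.injective_iff_surjective.1 hinj) l
  exact ⟨a, a.2, ha⟩

lemma eq_of_sub_eq_mul (hcop : Nat.Coprime m n)
    (h : ∀ j, f (τ j) = f j - n + k j * m) {j l : Fin m}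
    (hjl : ∃ z : ℤ, f j - f l = z * m) : j = l := by
  obtain ⟨a, ha, rfl⟩ := exists_lt_iterate_eq hcop h j l
  have := eq_of_lt_of_iterate_congr (a := 0) hcop h j.pos ha hjl
  subst this
  rfl

end Orbit

namespace IsClosedTrajectory

variable {m n : ℕ} {p : Fin n → Fin m} {X Y : Fin (n + 1) → Fin m → ℝ}

lemma exists_perm (hX : IsClosedTrajectory p X) (i : Fin (n + 1)) :
    ∃ (τ : Equiv.Perm (Fin m)) (k : Fin m → ℕ), ∀ j, X i (τ j) = X 0 j - i + k j * m := by
  induction i using Fin.induction with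
  | zero => exact ⟨1, 0, by simp⟩
  | succ i ih =>
    obtain ⟨τ, k, h⟩ := ih
    refine ⟨τ.trans (Tuple.sort fun j =>
      X i.castSucc j + (if j = p i then (m : ℝ) else 0) - 1).symm,
      fun j => k j + if τ j = p i then 1 else 0, fun j => ?_⟩
    rw [Equiv.trans_apply, hX.step, letterAct_sort_symm, h]
    push_cast [Fin.val_succ, Fin.val_castSucc]
    split_ifs <;> ring

lemma exists_perm_closed (hX : IsClosedTrajectory p X) :
    ∃ (τ : Equiv.Perm (Fin m)) (k : Fin m → ℕ), ∀ j, X 0 (τ j) = X 0 j - n + k j * m := by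
  have := hX.exists_perm (Fin.last n)
  rwa [hX.closed, Fin.val_last] at this

lemma eq_of_sub_eq_mul (hX : IsClosedTrajectory p X) (hcop : Nat.Coprime m n)
    (i : Fin (n + 1)) {j l : Fin m} (h : ∃ z : ℤ, X i j - X i l = z * m) : j = l := by
  obtain ⟨τ, k, hτ⟩ := hX.exists_perm_closed
  obtain ⟨σ, c, hσ⟩ := hX.exists_perm i
  obtain ⟨j, rfl⟩ := σ.surjective j
  obtain ⟨l, rfl⟩ := σ.surjective l
  obtain ⟨z, hz⟩ := h
  rw [hσ, hσ] at hz
  rw [_root_.eq_of_sub_eq_mul hcop hτ (j := j) (l := l)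
    ⟨z - c j + c l, by push_cast; linarith⟩]

lemma injective (hX : IsClosedTrajectory p X) (hcop : Nat.Coprime m n) (i : Fin (n + 1)) :
    Function.Injective (X i) :=
  fun j l h => hX.eq_of_sub_eq_mul hcop i ⟨0, by simp [h]⟩

lemma exists_int_sub (hX : IsClosedTrajectory p X) (hcop : Nat.Coprime m n)
    (i : Fin (n + 1)) (j l : Fin m) : ∃ z : ℤ, X i j - X 0 l = z := by
  obtain ⟨τ, k, hτ⟩ := hX.exists_perm_closed
  obtain ⟨σ, c, hσ⟩ := hX.exists_perm i
  obtain ⟨j, rfl⟩ := σ.surjective j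
  obtain ⟨a, -, rfl⟩ := exists_lt_iterate_eq hcop hτ l j
  obtain ⟨z, hz⟩ := exists_iterate_eq hτ a l
  refine ⟨z * m - a * n - i + c (τ^[a] l) * m, ?_⟩
  rw [hσ, hz]
  push_cast
  ring

lemma sum_sq_sub_step_le (hX : IsClosedTrajectory p X) (hY : IsClosedTrajectory p Y)
    (i : Fin n) :
    ∑ j, (X i.succ j - Y i.succ j) ^ 2 ≤ ∑ j, (X i.castSucc j - Y i.castSucc j) ^ 2 := by
  rw [hX.step, hY.step]
  refine ((sum_sq_sortTuple_sub_le _ _).1).trans_eq (Finset.sum_congr rfl fun j _ => ?_)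
  ring

/-- Two closed trajectories keep their squared distance, since no letter increases it. -/
lemma sum_sq_sub_step_eq (hX : IsClosedTrajectory p X) (hY : IsClosedTrajectory p Y)
    (i : Fin n) :
    ∑ j, (X i.succ j - Y i.succ j) ^ 2 = ∑ j, (X i.castSucc j - Y i.castSucc j) ^ 2 := by
  have hanti : Antitone fun i : Fin (n + 1) => ∑ j, (X i j - Y i j) ^ 2 :=
    Fin.antitone_iff_succ_le.2 (hX.sum_sq_sub_step_le hY)
  refine le_antisymm (hX.sum_sq_sub_step_le hY i) ?_
  have h1 := hanti (Fin.zero_le i.castSucc)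
  have h2 := hanti (Fin.le_last i.succ)
  simp only [hX.closed, hY.closed] at h1 h2
  exact h1.trans h2

lemma exists_perm_sub (hX : IsClosedTrajectory p X) (hY : IsClosedTrajectory p Y)
    (hcop : Nat.Coprime m n) (i : Fin (n + 1)) :
    ∃ (τ : Equiv.Perm (Fin m)) (k : Fin m → ℕ), ∀ j,
      X i (τ j) = X 0 j - i + k j * m ∧ X i (τ j) - Y i (τ j) = X 0 j - Y 0 j := by
  induction i using Fin.induction with
  | zero => exact ⟨1, 0, by simp⟩
  | succ i ih =>
    obtain ⟨τ, k, h⟩ := ih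
    set a : Fin m → ℝ := fun j => X i.castSucc j + (if j = p i then (m : ℝ) else 0) - 1 with ha
    set b : Fin m → ℝ := fun j => Y i.castSucc j + (if j = p i then (m : ℝ) else 0) - 1 with hb
    have hainj : Function.Injective a := by
      intro j l hjl
      refine hX.eq_of_sub_eq_mul hcop i.castSucc
        ⟨(if l = p i then 1 else 0) - (if j = p i then 1 else 0), ?_⟩
      simp only [ha] at hjl
      push_cast
      split_ifs at hjl ⊢ <;> linarith
    have heq := hX.sum_sq_sub_step_eq hY i
    rw [hX.step, hY.step] at heq
    have hab : ∀ j, a j - b j = X i.castSucc j - Y i.castSucc j := fun j => by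
      simp only [ha, hb]; ring
    have hYs : letterAct m (p i) (Y i.castSucc) = b ∘ Tuple.sort a :=
      (sum_sq_sortTuple_sub_le a b).2 hainj (heq.trans (by simp only [hab]))
    refine ⟨τ.trans (Tuple.sort a).symm,
      fun j => k j + if τ j = p i then 1 else 0, fun j => ?_⟩
    have hXj : X i.succ ((Tuple.sort a).symm (τ j)) = a (τ j) := by
      rw [hX.step]; exact letterAct_sort_symm m (p i) _ _
    have hYj : Y i.succ ((Tuple.sort a).symm (τ j)) = b (τ j) := by
      rw [hY.step, hYs]; simp
    rw [Equiv.trans_apply, hXj, hYj, hab, (h j).2]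
    refine ⟨?_, rfl⟩
    simp only [ha]
    rw [(h j).1]
    push_cast [Fin.val_succ, Fin.val_castSucc]
    split_ifs <;> ring

/-- Closed trajectories of the same word start at points that differ by a constant. -/
lemma sub_eq_sub (hX : IsClosedTrajectory p X) (hY : IsClosedTrajectory p Y)
    (hcop : Nat.Coprime m n) (j l : Fin m) : X 0 j - Y 0 j = X 0 l - Y 0 l := by
  obtain ⟨τ, k, hτ⟩ := hX.exists_perm_sub hY hcop (Fin.last n)
  simp only [hX.closed, hY.closed, Fin.val_last] at hτ
  obtain ⟨a, -, rfl⟩ := exists_lt_iterate_eq hcop (fun j => (hτ j).1) j l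
  clear * - hτ
  induction a with
  | zero => rfl
  | succ a ih => rw [ih, Function.iterate_succ_apply', (hτ _).2]

lemma eq_of_zero_eq (hX : IsClosedTrajectory p X) (hY : IsClosedTrajectory p Y)
    (h : X 0 = Y 0) : X = Y := by
  funext i
  induction i using Fin.induction with
  | zero => exact h
  | succ i ih => rw [hX.step, hY.step, ih]

lemma isParkingWord (hX : IsClosedTrajectory p X) :
    IsParkingWord m n (fun j => (p j : ℕ)) := by
  refine ⟨fun j => (p j).2, fun i _ him => ?_⟩
  set S : Fin (n + 1) → ℝ := fun k => ∑ j with j.val < i, X k j with hS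
  have hstep : ∀ k : Fin n, S k.succ - S k.castSucc ≤ (if (p k).val < i then (m : ℝ) else 0) - i := by
    intro k
    have h := sum_sortTuple_lt_le
      (fun j => X k.castSucc j + (if j = p k then (m : ℝ) else 0) - 1) i
    simp only [hS, hX.step, letterAct]
    refine (sub_le_sub_right h _).trans_eq ?_
    rw [Finset.sum_sub_distrib, Finset.sum_add_distrib]
    simp [Finset.sum_ite_eq', him, Fin.card_filter_val_lt]
    ring
  have hsum := Finset.sum_le_sum fun k (_ : k ∈ Finset.univ) => hstep k
  have hclosed : S (Fin.last n) = S 0 := by simp only [hS, hX.closed]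
  rw [Fin.sum_succ_sub_castSucc, hclosed, sub_self, Finset.sum_sub_distrib, ← Finset.sum_filter] at hsum
  simp only [Finset.sum_const, Finset.card_univ, Fintype.card_fin, nsmul_eq_mul] at hsum
  have : (i : ℝ) * n ≤ m * (Finset.univ.filter fun j => (p j).val < i).card := by linarith
  exact_mod_cast this

end IsClosedTrajectory

lemma partialAct_succ {m n : ℕ} (p : Fin n → Fin m) (i : Fin n) (x : Fin m → ℝ) :
    partialAct p (i + 1) x = letterAct m (p i) (partialAct p i x) := by
  simp [partialAct, List.take_add_one]

lemma partialAct_length {m n : ℕ} (p : Fin n → Fin m) (x : Fin m → ℝ) :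
    partialAct p n x = wordAct p x := by
  simp [partialAct, wordAct, List.take_of_length_le]

lemma monotone_partialAct {m n : ℕ} (p : Fin n → Fin m) {x : Fin m → ℝ} (hx : Monotone x)
    (i : Fin (n + 1)) : Monotone (partialAct p i x) := by
  cases i using Fin.cases with
  | zero => simpa [partialAct] using hx
  | succ i => rw [Fin.val_succ, partialAct_succ]; exact monotone_letterAct _ _ _

lemma sum_partialAct {m n : ℕ} (p : Fin n → Fin m) (x : Fin m → ℝ) (i : Fin (n + 1)) :
    ∑ j, partialAct p i x j = ∑ j, x j := by
  induction i using Fin.induction with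
  | zero => simp [partialAct]
  | succ i ih => rw [Fin.val_succ, partialAct_succ, sum_letterAct]; exact ih

lemma isClosedTrajectory_partialAct {m n : ℕ} {p : Fin n → Fin m} {x : Fin m → ℝ}
    (hx : Monotone x) (h : wordAct p x = x) :
    IsClosedTrajectory p (fun i : Fin (n + 1) => partialAct p i x) where
  mono := monotone_partialAct p hx
  step i := partialAct_succ p i x
  closed := by
    rw [Fin.val_last, partialAct_length, h]
    simp [partialAct]

lemma lipschitzWith_wordAct {m n : ℕ} (p : Fin n → Fin m) : LipschitzWith 1 (wordAct p) := by
  refine LipschitzWith.mk_one fun x y => ?_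
  have h : ∀ i : Fin (n + 1), dist (partialAct p i x) (partialAct p i y) ≤ dist x y := by
    intro i
    induction i using Fin.induction with
    | zero => simp [partialAct]
    | succ i ih =>
      rw [Fin.val_succ, partialAct_succ, partialAct_succ]
      exact (dist_letterAct_le _ _ _ _).trans ih
  rw [← partialAct_length, ← partialAct_length]
  exact h (Fin.last n)

lemma dist_partialAct_self_le {m n : ℕ} (p : Fin n → Fin m) {x : Fin m → ℝ} (hx : Monotone x)
    (i : Fin (n + 1)) : dist (partialAct p i x) x ≤ i * m := by
  induction i using Fin.induction with
  | zero => simp [partialAct]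
  | succ i ih =>
    have h := dist_letterAct_self_le (p i) (monotone_partialAct p hx i.castSucc)
    have h2 := dist_triangle (letterAct m (p i) (partialAct p i.castSucc x))
      (partialAct p i.castSucc x) x
    rw [Fin.val_succ, partialAct_succ]
    simp only [Fin.val_castSucc] at ih h h2
    push_cast
    linarith

lemma sum_mul_le_of_partial_sums_nonneg {d x : ℕ → ℝ} (hx : Monotone x) (M : ℕ)
    (hd : ∀ i < M, 0 ≤ ∑ j ∈ Finset.range (i + 1), d j) :
    ∑ j ∈ Finset.range (M + 1), d j * x j ≤ (∑ j ∈ Finset.range (M + 1), d j) * x M := by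
  induction M with
  | zero => simp
  | succ M ih =>
    rw [Finset.sum_range_succ, Finset.sum_range_succ (n := M + 1), add_mul]
    have h1 := ih fun i hi => hd i (by omega)
    have h2 := mul_le_mul_of_nonneg_left (hx (Nat.le_succ M)) (hd M (by omega))
    linarith

/-- By coprimality, all proper parking inequalities are strict, which makes a parking word push
the entries of a tuple together. -/
lemma IsParkingWord.mul_sum_le {m n : ℕ} (hm : 0 < m) (hcop : Nat.Coprime m n)
    {p : Fin n → Fin m} (hp : IsParkingWord m n (fun j => (p j : ℕ))) {x : Fin m → ℝ}
    (hx : x ∈ Vm m) :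
    m * ∑ k, x (p k) ≤ -(x ⟨m - 1, by omega⟩ - x ⟨0, hm⟩) := by
  obtain ⟨hsum, hmono⟩ := hx
  set y : ℕ → ℝ := fun j => x ⟨min j (m - 1), by omega⟩ with hy
  have hymono : Monotone y := fun a b hab => hmono (Fin.mk_le_mk.2 (by omega))
  have hyx : ∀ j : Fin m, y j = x j := fun j => by
    simp only [hy]; congr 1; ext; simp only; omega
  set c : ℕ → ℝ := fun j => (Finset.univ.filter fun k => (p k).val = j).card with hc
  set d : ℕ → ℝ := fun j =>
    m * c j - n - (if j = 0 then 1 else 0) + (if j = m - 1 then 1 else 0) with hd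
  have hC : ∀ i, ∑ j ∈ Finset.range i, c j =
      (Finset.univ.filter fun k => (p k).val < i).card := by
    intro i
    rw [Finset.card_eq_sum_card_fiberwise (f := fun k => (p k).val) (t := Finset.range i)
      (fun k hk => by simpa using hk)]
    push_cast
    refine Finset.sum_congr rfl fun j hj => ?_
    simp only [hc, Finset.filter_filter]
    congr 2
    ext k
    simp only [Finset.mem_filter, Finset.mem_univ, true_and, Finset.mem_range] at hj ⊢
    omega
  have hD : ∀ i, 0 < i → i ≤ m → ∑ j ∈ Finset.range i, d j =
      m * (Finset.univ.filter fun k => (p k).val < i).card - i * n - 1 +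
        if i = m then 1 else 0 := by
    intro i hi him
    simp only [hd, Finset.sum_add_distrib, Finset.sum_sub_distrib, ← Finset.mul_sum, hC,
      Finset.sum_const, Finset.card_range, nsmul_eq_mul, Finset.sum_ite_eq', Finset.mem_range, hi,
      if_true]
    congr 1
    refine if_congr ?_ rfl rfl
    omega
  have hmain := sum_mul_le_of_partial_sums_nonneg (d := d) hymono (m - 1) (fun i hi => by
    rw [hD (i + 1) (by omega) (by omega), if_neg (by omega)]
    have h1 := hp.2 (i + 1) (by omega) (by omega)
    have h2 : (i + 1) * n ≠ m * (Finset.univ.filter fun k => (p k).val < i + 1).card := by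
      intro h
      have h3 := Nat.le_of_dvd (by omega) (hcop.dvd_of_dvd_mul_right ⟨_, h⟩)
      omega
    have h3 : (i + 1) * n + 1 ≤ m * (Finset.univ.filter fun k => (p k).val < i + 1).card :=
      lt_of_le_of_ne h1 h2
    have h4 : (((i + 1 : ℕ) : ℝ)) * n + 1 ≤
        m * (Finset.univ.filter fun k => (p k).val < i + 1).card := by exact_mod_cast h3
    linarith)
  rw [Nat.sub_add_cancel hm, hD m hm le_rfl] at hmain
  simp only [Fin.is_lt, Finset.filter_true, Finset.card_univ, Fintype.card_fin, if_true] at hmain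
  have hcy : ∑ j ∈ Finset.range m, c j * y j = ∑ k, x (p k) := by
    rw [← Finset.sum_fiberwise_of_maps_to (s := Finset.univ) (t := Finset.range m)
      (g := fun k => (p k).val) (fun k _ => by simp)]
    refine Finset.sum_congr rfl fun j _ => ?_
    rw [hc, ← nsmul_eq_mul, ← Finset.sum_const]
    refine Finset.sum_congr rfl fun k hk => ?_
    rw [← hyx, (Finset.mem_filter.1 hk).2]
  have hdy : ∑ j ∈ Finset.range m, d j * y j =
      m * ∑ k, x (p k) - x ⟨0, hm⟩ + x ⟨m - 1, by omega⟩ := by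
    have hsy : ∑ j ∈ Finset.range m, y j = 0 := by
      rw [Finset.sum_range, ← hsum]
      exact Finset.sum_congr rfl fun j _ => hyx j
    simp only [hd, add_mul, sub_mul, Finset.sum_add_distrib, Finset.sum_sub_distrib, mul_assoc,
      ← Finset.mul_sum, hcy, hsy, ite_mul, one_mul, zero_mul, Finset.sum_ite_eq', Finset.mem_range]
    rw [if_pos hm, if_pos (by omega), ← hyx, ← hyx]
    simp
  rw [hdy] at hmain
  linarith

lemma sum_sq_wordAct_le {m n : ℕ} (p : Fin n → Fin m) {x : Fin m → ℝ} (hx : x ∈ Vm m) :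
    ∑ j, wordAct p x j ^ 2 ≤
      ∑ j, x j ^ 2 + 2 * m * ∑ k, x (p k) + n * (2 * m * (n * m) + m ^ 2) := by
  have hstep : ∀ k : Fin n,
      ∑ j, partialAct p k.succ x j ^ 2 - ∑ j, partialAct p k.castSucc x j ^ 2 ≤
        2 * m * x (p k) + (2 * m * (n * m) + m ^ 2) := by
    intro k
    have h1 := (dist_le_pi_dist (partialAct p k.castSucc x) x (p k)).trans
      (dist_partialAct_self_le p hx.2 k.castSucc)
    have h2 := (abs_le.1 h1).2
    have hkn : (k.castSucc.val : ℝ) * m ≤ n * m := by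
      gcongr
      exact k.2.le
    have h3 : partialAct p k x (p k) ≤ x (p k) + n * m := by
      simp only [Fin.val_castSucc] at h2 hkn
      linarith
    have h4 := mul_le_mul_of_nonneg_left h3 (by positivity : (0 : ℝ) ≤ 2 * m)
    have h5 := sum_partialAct p x k.castSucc
    rw [hx.1] at h5
    rw [Fin.val_succ, partialAct_succ, sum_sq_letterAct]
    simp only [Fin.val_castSucc] at h5 ⊢
    rw [h5]
    have : (0 : ℝ) ≤ m := by positivity
    linarith
  have h := Finset.sum_le_sum fun k (_ : k ∈ Finset.univ) => hstep k
  rw [Fin.sum_succ_sub_castSucc (fun k => ∑ j, partialAct p k x j ^ 2), Finset.sum_add_distrib,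
    ← Finset.mul_sum, Fin.val_last, partialAct_length] at h
  simp only [Finset.sum_const, Finset.card_univ, Fintype.card_fin, nsmul_eq_mul] at h
  have h0 : partialAct p ((0 : Fin (n + 1)) : ℕ) x = x := by simp [partialAct]
  rw [h0] at h
  linarith

lemma abs_le_of_mem_Vm {m : ℕ} (hm : 0 < m) {x : Fin m → ℝ} (hx : x ∈ Vm m) (j : Fin m) :
    |x j| ≤ x ⟨m - 1, by omega⟩ - x ⟨0, hm⟩ := by
  obtain ⟨hsum, hmono⟩ := hx
  have hlo : ∀ j, x ⟨0, hm⟩ ≤ x j := fun j => hmono (Fin.mk_le_mk.2 (Nat.zero_le _))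
  have hhi : ∀ j, x j ≤ x ⟨m - 1, by omega⟩ := fun j => hmono (Fin.mk_le_mk.2 (by omega))
  have hm' : (0 : ℝ) < m := by exact_mod_cast hm
  have h1 := Finset.card_nsmul_le_sum Finset.univ x _ (fun j _ => hlo j)
  have h2 := Finset.sum_le_card_nsmul Finset.univ x _ (fun j _ => hhi j)
  rw [hsum, Finset.card_univ, Fintype.card_fin, nsmul_eq_mul] at h1 h2
  have h3 : x ⟨0, hm⟩ ≤ 0 := by
    by_contra! h
    linarith [mul_pos hm' h]
  have h4 : 0 ≤ x ⟨m - 1, by omega⟩ := by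
    by_contra! h
    linarith [mul_neg_of_pos_of_neg hm' h]
  rw [abs_le]
  constructor <;> linarith [hlo j, hhi j]

lemma wordAct_mem_Vm {m n : ℕ} (p : Fin n → Fin m) {x : Fin m → ℝ} (hx : x ∈ Vm m) :
    wordAct p x ∈ Vm m := by
  rw [← partialAct_length]
  exact ⟨(sum_partialAct p x (Fin.last n)).trans hx.1, monotone_partialAct p hx.2 (Fin.last n)⟩

/-- A parking word preserves the points of `Vm m` in a large enough ball. -/
lemma IsParkingWord.exists_mapsTo {m n : ℕ} (hm : 0 < m) (hcop : Nat.Coprime m n)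
    {p : Fin n → Fin m} (hp : IsParkingWord m n (fun j => (p j : ℕ))) :
    ∃ R : ℝ, 0 ≤ R ∧ Set.MapsTo (wordAct p) {x | x ∈ Vm m ∧ ∑ j, x j ^ 2 ≤ R}
      {x | x ∈ Vm m ∧ ∑ j, x j ^ 2 ≤ R} := by
  set C : ℝ := n * (2 * m * (n * m) + m ^ 2) with hC
  have hC0 : 0 ≤ C := by positivity
  refine ⟨m * C ^ 2 + C, by positivity, fun x hx => ⟨wordAct_mem_Vm p hx.1, ?_⟩⟩
  have h1 := sum_sq_wordAct_le p hx.1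
  have h2 := hp.mul_sum_le hm hcop hx.1
  have habs := abs_le_of_mem_Vm hm hx.1
  have hw0 := (abs_nonneg _).trans (habs ⟨0, hm⟩)
  set w := x ⟨m - 1, by omega⟩ - x ⟨0, hm⟩
  rw [← hC] at h1
  rcases le_total C w with h | h
  · linarith [hx.2]
  · have h3 : ∑ j, x j ^ 2 ≤ m * C ^ 2 := by
      have := Finset.sum_le_card_nsmul Finset.univ (fun j => x j ^ 2) (C ^ 2)
        (fun j _ => sq_le_sq' (by linarith [(abs_le.1 (habs j)).1])
          ((abs_le.1 (habs j)).2.trans h))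
      simpa using this
    linarith

lemma StarConvex.exists_fixedPoint_of_lipschitzWith_one {E : Type*} [NormedAddCommGroup E]
    [NormedSpace ℝ E] {K : Set E} (hK : IsCompact K) (h0 : (0 : E) ∈ K) (hstar : StarConvex ℝ 0 K)
    {F : E → E} (hmaps : Set.MapsTo F K K) (hF : LipschitzWith 1 F) : ∃ x ∈ K, F x = x := by
  obtain ⟨x, hxK, hmin⟩ := hK.exists_isMinOn ⟨0, h0⟩
    (f := fun x => dist (F x) x) (hF.continuous.dist continuous_id).continuousOn
  refine ⟨x, hxK, dist_le_zero.1 ?_⟩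
  by_contra! hv
  set v := dist (F x) x
  obtain ⟨B, hB0, hB⟩ := hK.isBounded.exists_pos_norm_le
  set ε : ℝ := v / (B + v) with hε
  have hε0 : 0 < ε := by positivity
  have hε1 : ε < 1 := by rw [hε, div_lt_one (by positivity)]; linarith
  have hεB : ε * B < v := by
    rw [hε, div_mul_eq_mul_div, div_lt_iff₀ (by positivity)]
    nlinarith
  have hmaps' : Set.MapsTo (fun y => (1 - ε) • F y) K K := fun y hy => by
    have := hstar (hmaps hy) hε0.le (by linarith : 0 ≤ 1 - ε) (by ring)
    simpa using this
  have hcon : ContractingWith (1 - ε).toNNReal (hmaps'.restrict _ K K) := by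
    refine ⟨by rw [← NNReal.coe_lt_coe, Real.coe_toNNReal _ (by linarith)]; simpa, ?_⟩
    refine LipschitzWith.of_dist_le_mul fun a b => ?_
    rw [Real.coe_toNNReal _ (by linarith), Subtype.dist_eq, Subtype.dist_eq]
    simp only [Set.MapsTo.val_restrict_apply]
    rw [dist_smul₀, Real.norm_of_nonneg (by linarith)]
    exact mul_le_mul_of_nonneg_left (by simpa using hF.dist_le_mul a.1 b.1) (by linarith)
  obtain ⟨y, hyK, hy, -⟩ := hcon.exists_fixedPoint' hK.isComplete hmaps' h0 (edist_ne_top _ _)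
  have hy' : (1 - ε) • F y = y := hy
  have h1 : v ≤ dist (F y) y := hmin hyK
  have h2 : dist (F y) y = ε * ‖F y‖ := by
    nth_rewrite 2 [← hy']
    rw [dist_eq_norm, sub_smul, one_smul, sub_sub_cancel, norm_smul, Real.norm_of_nonneg hε0.le]
  have h3 := mul_le_mul_of_nonneg_left (hB _ (hmaps hyK)) hε0.le
  linarith

lemma IsParkingWord.exists_fixedPoint {m n : ℕ} (hm : 0 < m) (hcop : Nat.Coprime m n)
    {p : Fin n → Fin m} (hp : IsParkingWord m n (fun j => (p j : ℕ))) :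
    ∃ x ∈ Vm m, wordAct p x = x := by
  obtain ⟨R, hR, hmaps⟩ := hp.exists_mapsTo hm hcop
  set K : Set (Fin m → ℝ) := {x | x ∈ Vm m ∧ ∑ j, x j ^ 2 ≤ R}
  have hclosed : IsClosed K := by
    refine IsClosed.inter (IsClosed.inter ?_ isClosed_monotone) ?_
    · exact isClosed_eq (continuous_finsetSum _ fun j _ => continuous_apply j) continuous_const
    · exact isClosed_le (continuous_finsetSum _ fun j _ => (continuous_apply j).pow 2)
        continuous_const
  have hbdd : Bornology.IsBounded K := by
    refine isBounded_iff_forall_norm_le.2 ⟨R + 1, fun x hx => ?_⟩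
    refine (pi_norm_le_iff_of_nonneg (by positivity)).2 fun j => ?_
    have h1 := (Finset.single_le_sum (f := fun j => x j ^ 2) (fun j _ => sq_nonneg _)
      (Finset.mem_univ j)).trans hx.2
    exact abs_le_of_sq_le_sq (by nlinarith) (by positivity)
  have h0 : (0 : Fin m → ℝ) ∈ K := ⟨⟨by simp, monotone_const⟩, by simpa using hR⟩
  have hstar : StarConvex ℝ 0 K := by
    refine starConvex_zero_iff.2 fun x hx a ha0 ha1 => ⟨⟨?_, ?_⟩, ?_⟩
    · simp [← Finset.mul_sum, hx.1.1]
    · exact fun i j hij => mul_le_mul_of_nonneg_left (hx.1.2 hij) ha0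
    · simp only [Pi.smul_apply, smul_eq_mul, mul_pow, ← Finset.mul_sum]
      have h1 : a ^ 2 ≤ 1 := pow_le_one₀ ha0 ha1
      have h2 : 0 ≤ ∑ j, x j ^ 2 := Finset.sum_nonneg fun j _ => sq_nonneg _
      exact (mul_le_of_le_one_left h2 h1).trans hx.2
  obtain ⟨x, hx, hfix⟩ := hstar.exists_fixedPoint_of_lipschitzWith_one
    (Metric.isCompact_of_isClosed_isBounded hclosed hbdd) h0 hmaps (lipschitzWith_wordAct p)
  exact ⟨x, hx.1, hfix⟩

lemma Monotone.eq_of_map_univ_eq {α : Type*} [PartialOrder α] {m : ℕ} {f g : Fin m → α}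
    (hf : Monotone f) (hg : Monotone g)
    (h : Multiset.map f Finset.univ.val = Multiset.map g Finset.univ.val) : f = g := by
  rw [Fin.univ_val_map, Fin.univ_val_map, Multiset.coe_eq_coe] at h
  exact List.ofFn_injective (h.eq_of_sortedLE hf.sortedLE_ofFn hg.sortedLE_ofFn)

lemma map_univ_add_ite {m : ℕ} (f : Fin m → ℤ) (i : Fin m) (c : ℤ) :
    Multiset.map (fun j => f j + if j = i then c else 0) Finset.univ.val =
      (f i + c) ::ₘ (Multiset.map f Finset.univ.val).erase (f i) := by
  have hi : i ∈ (Finset.univ : Finset (Fin m)).val := Finset.mem_univ i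
  rw [← Multiset.cons_erase hi, Multiset.map_cons, Multiset.map_cons, Multiset.erase_cons_head,
    if_pos rfl]
  congr 1
  refine Multiset.map_congr rfl fun j hj => ?_
  rw [if_neg ((Finset.univ.nodup.mem_erase_iff.1 hj).1), add_zero]

lemma map_univ_comp_perm {α : Type*} {m : ℕ} (f : Fin m → α) (σ : Equiv.Perm (Fin m)) :
    Multiset.map (f ∘ σ) Finset.univ.val = Multiset.map f Finset.univ.val := by
  rw [← Multiset.map_map, Multiset.map_univ_val_equiv]

lemma card_filter_apply_lt {m : ℕ} {f : Fin m → ℤ} (hf : StrictMono f) (i : Fin m) :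
    (Finset.univ.filter fun j => f j < f i).card = i := by
  simp only [hf.lt_iff_lt]
  rw [← Fin.card_Iio]
  congr 1
  ext j
  simp

namespace ParkingTuple

variable {m n : ℕ}

lemma strictMono (t : ParkingTuple m n) (i : Fin (n + 1)) : StrictMono (t.r i) :=
  (t.mono i).strictMono_of_injective fun j k h => t.res i j k (by simp [h])

lemma exists_apply_eq_removed (t : ParkingTuple m n) (i : Fin n) :
    ∃ j, t.r i.castSucc j = t.removed i := by
  simpa using t.mem i

/-- The word of a parking tuple, with letters in `Fin m`. -/
noncomputable def word (t : ParkingTuple m n) (i : Fin n) : Fin m :=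
  (t.exists_apply_eq_removed i).choose

lemma apply_word (t : ParkingTuple m n) (i : Fin n) :
    t.r i.castSucc (t.word i) = t.removed i :=
  (t.exists_apply_eq_removed i).choose_spec

lemma Brank_eq_word (t : ParkingTuple m n) (i : Fin n) : Brank t i = t.word i := by
  rw [Brank, ← t.apply_word]
  exact card_filter_apply_lt (t.strictMono _) _

/-- The levels of a parking tuple, shifted so that they return to their starting values. -/
def point (t : ParkingTuple m n) (i : Fin (n + 1)) (j : Fin m) : ℝ :=
  t.r i j - (i : ℕ)

lemma isClosedTrajectory (t : ParkingTuple m n) : IsClosedTrajectory t.word t.point where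
  mono i j k hjk := sub_le_sub_right (Int.cast_le.2 (t.mono i hjk)) _
  step i := by
    set b : Fin m → ℤ := fun j =>
      t.r i.castSucc j + if j = t.word i then (m : ℤ) else 0 with hb
    have hr : t.r i.succ = b ∘ Tuple.sort b := by
      refine (t.mono _).eq_of_map_univ_eq (Tuple.monotone_sort b) ?_
      rw [map_univ_comp_perm, t.step, hb, map_univ_add_ite, t.apply_word]
    set a : Fin m → ℝ := fun j =>
      t.point i.castSucc j + (if j = t.word i then (m : ℝ) else 0) - 1 with ha
    have hab : ∀ j, a j = b j - (i.succ.val : ℝ) := by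
      intro j
      simp only [ha, hb, point]
      push_cast [Fin.val_succ, Fin.val_castSucc]
      ring
    have hmono : Monotone (a ∘ Tuple.sort b) := by
      intro j k hjk
      simp only [Function.comp, hab]
      exact sub_le_sub_right (Int.cast_le.2 (Tuple.monotone_sort b hjk)) _
    have hsort : letterAct m (t.word i) (t.point i.castSucc) = a ∘ Tuple.sort b :=
      (Tuple.comp_sort_eq_comp_iff_monotone.2 hmono).symm
    rw [hsort]
    funext j
    simp only [Function.comp, hab, point, hr]
  closed := by
    funext j
    simp [point, t.last]

lemma Brank_injective (hcop : Nat.Coprime m n) :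
    Function.Injective (fun t : ParkingTuple m n => Brank t) := by
  intro t t' h
  have hword : t.word = t'.word := by
    funext i
    apply Fin.ext
    rw [← t.Brank_eq_word, ← t'.Brank_eq_word]
    exact congrFun h i
  have ht := t.isClosedTrajectory
  have ht' := t'.isClosedTrajectory
  rw [← hword] at ht'
  have hpoint : t.point = t'.point := by
    refine ht.eq_of_zero_eq ht' ?_
    obtain ⟨j, hj⟩ := t.zero_min
    obtain ⟨j', hj'⟩ := t'.zero_min
    have hd : ∀ k l, t.r 0 k - t'.r 0 k = t.r 0 l - t'.r 0 l := by
      intro k l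
      have := ht.sub_eq_sub ht' hcop k l
      simp only [point, Fin.val_zero, Nat.cast_zero, sub_zero] at this
      exact_mod_cast this
    funext k
    have h1 := hd k j
    have h2 := hd k j'
    have h3 := t'.nonneg j
    have h4 := t.nonneg j'
    have : t.r 0 k = t'.r 0 k := by omega
    simp [point, this]
  have hr : t.r = t'.r := by
    funext i j
    have := congrFun (congrFun hpoint i) j
    simp only [point, sub_left_inj] at this
    exact_mod_cast this
  have hrem : t.removed = t'.removed := by
    funext i
    rw [← t.apply_word, ← t'.apply_word, hr, hword]
  cases t
  cases t'
  simp only at hr hrem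
  subst hr hrem
  rfl

end ParkingTuple

/-- The integer levels of a closed trajectory form a parking tuple. -/
lemma IsClosedTrajectory.exists_parkingTuple {m n : ℕ} (hm : 0 < m) (hcop : Nat.Coprime m n)
    {p : Fin n → Fin m} {X : Fin (n + 1) → Fin m → ℝ} (hX : IsClosedTrajectory p X) :
    ∃ t : ParkingTuple m n, Brank t = fun i => (p i : ℕ) := by
  choose z hz using fun i j => hX.exists_int_sub hcop i j ⟨0, hm⟩
  set r : Fin (n + 1) → Fin m → ℤ := fun i j => z i j + (i : ℕ) with hr
  have hrX : ∀ i j, (r i j : ℝ) = X i j - X 0 ⟨0, hm⟩ + (i : ℕ) := by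
    intro i j
    rw [hz]
    simp [hr]
  have hmono : ∀ i, Monotone (r i) := by
    intro i j k hjk
    have := hX.mono i hjk
    have h : (r i j : ℝ) ≤ r i k := by rw [hrX, hrX]; linarith
    exact_mod_cast h
  have hres : ∀ i, ∀ j k : Fin m, (m : ℤ) ∣ (r i j - r i k) → j = k := by
    rintro i j k ⟨c, hc⟩
    refine hX.eq_of_sub_eq_mul hcop i ⟨c, ?_⟩
    have h : ((r i j - r i k : ℤ) : ℝ) = (m * c : ℤ) := by rw [hc]
    push_cast at h
    rw [hrX, hrX] at h
    linarith
  have hzero : r 0 ⟨0, hm⟩ = 0 := by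
    have h : (r 0 ⟨0, hm⟩ : ℝ) = 0 := by rw [hrX]; simp
    exact_mod_cast h
  let t : ParkingTuple m n :=
    { r := r
      removed := fun i => r i.castSucc (p i)
      mono := hmono
      res := hres
      nonneg := fun j => hzero.symm.le.trans (hmono 0 (Fin.mk_le_mk.2 (Nat.zero_le _)))
      zero_min := ⟨⟨0, hm⟩, hzero⟩
      closed := by
        obtain ⟨τ, k, hτ⟩ := hX.exists_perm_closed
        intro j
        obtain ⟨l, rfl⟩ := τ.surjective j
        refine ⟨l, k l, ?_⟩
        have h : (r 0 (τ l) : ℝ) + n = r 0 l + k l * m := by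
          rw [hrX, hrX, hτ]
          ring
        exact_mod_cast h
      mem := fun i => Multiset.mem_map_of_mem _ (Finset.mem_univ (p i))
      step := by
        intro i
        rw [← map_univ_add_ite, ← map_univ_comp_perm (r i.succ) (Tuple.sort fun j =>
          X i.castSucc j + (if j = p i then (m : ℝ) else 0) - 1).symm]
        congr 1
        funext j
        have h : (r i.succ ((Tuple.sort fun j =>
            X i.castSucc j + (if j = p i then (m : ℝ) else 0) - 1).symm j) : ℝ) =
            r i.castSucc j + if j = p i then (m : ℝ) else 0 := by
          rw [hrX, hrX, hX.step, letterAct_sort_symm]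
          push_cast [Fin.val_succ, Fin.val_castSucc]
          ring
        rw [Function.comp]
        exact_mod_cast h
      last := by
        intro j
        have h : (r (Fin.last n) j : ℝ) = r 0 j + n := by
          rw [hrX, hrX, hX.closed]
          simp
        exact_mod_cast h }
  refine ⟨t, funext fun i => ?_⟩
  exact card_filter_apply_lt (t.strictMono i.castSucc) (p i)

lemma range_Brank {m n : ℕ} (hm : 0 < m) (hcop : Nat.Coprime m n) :
    Set.range (fun t : ParkingTuple m n => Brank t) = {q : Fin n → ℕ | IsParkingWord m n q} := by
  ext q
  constructor
  · rintro ⟨t, rfl⟩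
    have h : Brank t = fun i => (t.word i : ℕ) := funext t.Brank_eq_word
    simp only [Set.mem_ofPred_eq, h]
    exact t.isClosedTrajectory.isParkingWord
  · intro hq
    set p : Fin n → Fin m := fun i => ⟨q i, hq.1 i⟩
    have hp : IsParkingWord m n (fun j => (p j : ℕ)) := hq
    obtain ⟨x, hx, hfix⟩ := hp.exists_fixedPoint hm hcop
    exact (isClosedTrajectory_partialAct hx.2 hfix).exists_parkingTuple hm hcop

/-- A word is determined by the intermediate points of its action on a fixed point. -/
lemma word_eq_of_partialAct_eq {m n : ℕ} (hcop : Nat.Coprime m n) {p p' : Fin n → Fin m}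
    {x : Fin m → ℝ} (hx : Monotone x) (hfix : wordAct p x = x)
    (h : ∀ i : ℕ, i ≤ n → partialAct p i x = partialAct p' i x) : p = p' := by
  funext i
  have hinj := (isClosedTrajectory_partialAct hx hfix).injective hcop i.castSucc
  refine letter_eq_of_letterAct_eq hinj ?_
  have h1 := h (i + 1) i.2
  rwa [partialAct_succ, partialAct_succ, ← h i i.2.le] at h1

/-- The sequence of intermediate points obtained from the unique fixed point of a
parking word determines the word; consequently the map `B` is injective on
parking (m,n)-filter tuples, and its image is exactly the set of
(m,n)-parking words. -/
theorem B_injective_image_parking_words (m n : ℕ) (hm : 0 < m) (hn : 0 < n)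
    (hcop : Nat.Coprime m n) :
    (∀ p p' : Fin n → Fin m,
      IsParkingWord m n (fun j => (p j : ℕ)) →
      IsParkingWord m n (fun j => (p' j : ℕ)) →
      ∀ x : Fin m → ℝ, x ∈ Vm m → wordAct p x = x → wordAct p' x = x →
      (∀ i : ℕ, i ≤ n → partialAct p i x = partialAct p' i x) → p = p') ∧
    Function.Injective (fun t : ParkingTuple m n => Brank t) ∧
    Set.range (fun t : ParkingTuple m n => Brank t) =
      {q : Fin n → ℕ | IsParkingWord m n q} := by
  exact ⟨fun p p' _ _ x hx hfix _ h => word_eq_of_partialAct_eq hcop hx.2 hfix h,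
    ParkingTuple.Brank_injective hcop, range_Brank hm hcop⟩
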